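/- arXiv:2505.20748 — 13 statements merged into one kernel-verified Lean document; each statement's English description precedes it below -/
import Mathlib

section
/- Let M = (S, A, d_init, δ) be an MDP, let (T,π) be an MEC-closed sub-MDP of M, let s ∈ T, and let C_s be the SCC of s in G(T,π). If ROut_{(T,π)}(C_s) = ∅, then MEC_M(s) exists and equals (C_s, π|_{C_s}). -/
/-- A Markov Decision Process over a finite nonempty state type `S` and a finite
action type `A`: an initial probability distribution over states, and a transition
function `δ : S × A × S → [0,1]` such that for each state `s` and action `α`, the
total outgoing mass `∑ s', δ s α s'` is `0` or `1`.  An action `α` is *enabled* in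
`s` if this sum is `1`; every state has at least one enabled action, and every
action is enabled in some state. -/
structure MDP (S A : Type*) [Fintype S] [Nonempty S] [Fintype A] where
  dinit : S → ℝ
  dinit_nonneg : ∀ s, 0 ≤ dinit s
  dinit_sum_one : (∑ s, dinit s) = 1
  δ : S → A → S → ℝ
  δ_nonneg : ∀ s α t, 0 ≤ δ s α t
  δ_le_one : ∀ s α t, δ s α t ≤ 1
  δ_sum_zero_or_one : ∀ s α, (∑ t, δ s α t) = 0 ∨ (∑ t, δ s α t) = 1
  exists_enabled : ∀ s, ∃ α, (∑ t, δ s α t) = 1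
  enabled_somewhere : ∀ α, ∃ s, (∑ t, δ s α t) = 1

variable {S A : Type*} [Fintype S] [Nonempty S] [Fintype A]

namespace MDP

/-- Action `α` is enabled in state `s`. -/
def Enabled (M : MDP S A) (s : S) (α : A) : Prop := (∑ t, M.δ s α t) = 1

/-- `(T, π)` is a sub-MDP of `M`: `T` is a nonempty set of states, each `s ∈ T` has a
nonempty set `π s` of enabled actions, and taking an action of `π s` from `s ∈ T`
stays inside `T` (self-containment). -/
def IsSubMDP (M : MDP S A) (T : Set S) (π : S → Set A) : Prop :=
  T.Nonempty ∧
  (∀ s ∈ T, (π s).Nonempty ∧ ∀ α ∈ π s, M.Enabled s α) ∧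
  (∀ s ∈ T, ∀ α ∈ π s, ∀ t, 0 < M.δ s α t → t ∈ T)

end MDP

/-- Sub-MDP inclusion: `(T₁,π₁) ⊆ (T₂,π₂)`. -/
def SubMDPIncl (T₁ : Set S) (π₁ : S → Set A) (T₂ : Set S) (π₂ : S → Set A) : Prop :=
  T₁ ⊆ T₂ ∧ ∀ s ∈ T₁, π₁ s ⊆ π₂ s

/-- The state-action pair set `sa(T,π)` of a sub-MDP. -/
def saSet (T : Set S) (π : S → Set A) : Set (S × A) :=
  {p | p.1 ∈ T ∧ p.2 ∈ π p.1}

/-- The restriction `π|_C` of an action assignment to a subset `C` of states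
(empty outside `C`). -/
def restrictTo (π : S → Set A) (C : Set S) : S → Set A :=
  fun s => {α ∈ π s | s ∈ C}

namespace MDP

/-- The labelled edge relation of the underlying graph `G(T,π)`:
there is an edge `(s,α,t)` with `s ∈ T`, `α ∈ π s`, `δ s α t > 0`. -/
def Step (M : MDP S A) (T : Set S) (π : S → Set A) (s t : S) : Prop :=
  s ∈ T ∧ ∃ α ∈ π s, 0 < M.δ s α t

/-- Reachability (by a possibly empty path of labelled edges) in `G(T,π)`. -/
def Reach (M : MDP S A) (T : Set S) (π : S → Set A) (s t : S) : Prop :=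
  Relation.ReflTransGen (M.Step T π) s t

/-- The forward-reachable set `F_s` of `s` in `G(T,π)`. -/
def Fwd (M : MDP S A) (T : Set S) (π : S → Set A) (s : S) : Set S :=
  {t ∈ T | M.Reach T π s t}

/-- The strongly connected component `C_s` of `s` in `G(T,π)`. -/
def SCC (M : MDP S A) (T : Set S) (π : S → Set A) (s : S) : Set S :=
  {t ∈ T | M.Reach T π s t ∧ M.Reach T π t s}

/-- `(T,π)` is an end-component of `M`: a sub-MDP in which every state can reach
every other state within `G(T,π)`. -/
def IsEC (M : MDP S A) (T : Set S) (π : S → Set A) : Prop :=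
  M.IsSubMDP T π ∧ ∀ s ∈ T, ∀ t ∈ T, M.Reach T π s t

/-- `(T,π)` is a maximal end-component (MEC) of `M`: an end-component maximal with
respect to sub-MDP inclusion. -/
def IsMEC (M : MDP S A) (T : Set S) (π : S → Set A) : Prop :=
  M.IsEC T π ∧
  ∀ T' π', M.IsEC T' π' → SubMDPIncl T π T' π' → SubMDPIncl T' π' T π

/-- `(T,π)` is MEC-closed: for every `s ∈ T`, if the MEC of `s` exists then it is
included in `(T,π)`. -/
def MECClosed (M : MDP S A) (T : Set S) (π : S → Set A) : Prop :=
  ∀ s ∈ T, ∀ T' π', M.IsMEC T' π' → s ∈ T' → SubMDPIncl T' π' T π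

/-- The random out `ROut_{(T,π)}(U)`: state-action pairs of `(T,π)` starting in `U`
that can go outside `U`. -/
def ROut (M : MDP S A) (T : Set S) (π : S → Set A) (U : Set S) : Set (S × A) :=
  {p | p.1 ∈ U ∧ p.2 ∈ π p.1 ∧ ∃ t ∈ T \ U, 0 < M.δ p.1 p.2 t}

/-- The approximation sequence `(S_i, X_i)` for the attractor of a state-action pair
set `X` in `(T,π)`. -/
def AttrSeq (M : MDP S A) (T : Set S) (π : S → Set A) (X : Set (S × A)) :
    ℕ → Set S × Set (S × A)
  | 0 => ({s ∈ T | ∀ α ∈ π s, (s, α) ∈ X}, X)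
  | n + 1 =>
    let P := M.AttrSeq T π X n
    let Xn : Set (S × A) := P.2 ∪ {p ∈ saSet T π | ∃ t ∈ P.1, 0 < M.δ p.1 p.2 t}
    (P.1 ∪ {s ∈ T | ∀ α ∈ π s, (s, α) ∈ Xn}, Xn)

/-- The attractor `Attr_{(T,π)}(X) = (⋃ i, S_i, ⋃ i, X_i)`. -/
def Attr (M : MDP S A) (T : Set S) (π : S → Set A) (X : Set (S × A)) :
    Set S × Set (S × A) :=
  (⋃ n, (M.AttrSeq T π X n).1, ⋃ n, (M.AttrSeq T π X n).2)

/-- The edge set of the underlying graph `G(T,π)`. -/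
def edgeSet (M : MDP S A) (T : Set S) (π : S → Set A) : Set (S × A × S) :=
  {e | e.1 ∈ T ∧ e.2.1 ∈ π e.1 ∧ 0 < M.δ e.1 e.2.1 e.2.2}

/-- `MECs_M(W)`: the set of MECs (in canonical form, with the action map empty
outside the state set) of states in `W`. -/
def MECsOf (M : MDP S A) (W : Set S) : Set (Set S × (S → Set A)) :=
  {p | (∃ t ∈ W, t ∈ p.1) ∧ M.IsMEC p.1 p.2 ∧ ∀ u, u ∉ p.1 → p.2 u = ∅}

end MDP
theorem reach_mono_aux (M : MDP S A) {T₁ : Set S} {π₁ : S → Set A} {T₂ : Set S} {π₂ : S → Set A}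
    (h : SubMDPIncl T₁ π₁ T₂ π₂) {u v : S} (hr : M.Reach T₁ π₁ u v) : M.Reach T₂ π₂ u v := by
  refine Relation.ReflTransGen.mono ?_ _ _ hr
  rintro a b ⟨ha, α, hα, hp⟩
  exact ⟨h.1 ha, α, h.2 a ha hα, hp⟩

theorem exists_mec_aux (M : MDP S A) (s : S) (T₀ : Set S) (π₀ : S → Set A)
    (h0 : M.IsEC T₀ π₀) (hs0 : s ∈ T₀) :
    ∃ T' π', M.IsMEC T' π' ∧ s ∈ T' ∧ SubMDPIncl T₀ π₀ T' π' := by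
  let U : Set S := {u | ∃ T π, M.IsEC T π ∧ s ∈ T ∧ u ∈ T}
  let ρ : S → Set A := fun u => {α | ∃ T π, M.IsEC T π ∧ s ∈ T ∧ u ∈ T ∧ α ∈ π u}
  have hincl : ∀ T π, M.IsEC T π → s ∈ T → SubMDPIncl T π U ρ := fun T π h hs =>
    ⟨fun u hu => ⟨T, π, h, hs, hu⟩, fun u hu α hα => ⟨T, π, h, hs, hu, hα⟩⟩
  have hsU : s ∈ U := ⟨T₀, π₀, h0, hs0, hs0⟩
  refine ⟨U, ρ, ⟨⟨⟨⟨s, hsU⟩, ?_, ?_⟩, ?_⟩, ?_⟩, hsU, hincl _ _ h0 hs0⟩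
  · rintro u ⟨T, π, h, hs, hu⟩
    refine ⟨?_, ?_⟩
    · obtain ⟨α, hα⟩ := (h.1.2.1 u hu).1
      exact ⟨α, T, π, h, hs, hu, hα⟩
    · rintro α ⟨T, π, h, hs, hu, hα⟩
      exact (h.1.2.1 u hu).2 α hα
  · rintro u - α ⟨T, π, h, hs, hu, hα⟩ t ht
    exact ⟨T, π, h, hs, h.1.2.2 u hu α hα t ht⟩
  · rintro u ⟨T, π, h, hs, hu⟩ v ⟨T', π', h', hs', hv⟩
    exact Relation.ReflTransGen.trans (reach_mono_aux M (hincl _ _ h hs) (h.2 u hu s hs))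
      (reach_mono_aux M (hincl _ _ h' hs') (h'.2 s hs' v hv))
  · intro T' π' h' hi
    exact hincl _ _ h' (hi.1 hsU)

/-- Let `M` be an MDP, `(T,π)` an MEC-closed sub-MDP of `M`, `s ∈ T`,
and `C_s` the SCC of `s` in `G(T,π)`.  If `ROut_{(T,π)}(C_s) = ∅`, then `MEC_M(s)`
exists and equals `(C_s, π|_{C_s})` (i.e. `s` lies in `C_s` and
`(C_s, π|_{C_s})` is a MEC of `M`; MECs containing a given state are unique). -/
theorem stmt0 (M : MDP S A) (T : Set S) (π : S → Set A)
    (hsub : M.IsSubMDP T π) (hclosed : M.MECClosed T π)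
    (s : S) (hs : s ∈ T)
    (hrout : M.ROut T π (M.SCC T π s) = ∅) :
    s ∈ M.SCC T π s ∧ M.IsMEC (M.SCC T π s) (restrictTo π (M.SCC T π s)) := by
  have hsC : s ∈ M.SCC T π s := ⟨hs, Relation.ReflTransGen.refl, Relation.ReflTransGen.refl⟩
  have hcl : ∀ u ∈ M.SCC T π s, ∀ α ∈ π u, ∀ t, 0 < M.δ u α t → t ∈ M.SCC T π s := by
    intro u hu α hα t ht
    by_contra hn
    have : (u, α) ∈ M.ROut T π (M.SCC T π s) :=
      ⟨hu, hα, t, ⟨hsub.2.2 u hu.1 α hα t ht, hn⟩, ht⟩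
    rw [hrout] at this
    exact this
  refine ⟨hsC, ⟨⟨⟨s, hsC⟩, ?_, ?_⟩, ?_⟩, ?_⟩
  · intro u hu
    obtain ⟨⟨α, hα⟩, h2⟩ := hsub.2.1 u hu.1
    exact ⟨⟨α, hα, hu⟩, fun β hβ => h2 β hβ.1⟩
  · intro u hu α hα t ht
    exact hcl u hu α hα.1 t ht
  · intro u hu v hv
    have hr : M.Reach T π u v := Relation.ReflTransGen.trans hu.2.2 hv.2.1
    have key : v ∈ M.SCC T π s ∧
        M.Reach (M.SCC T π s) (restrictTo π (M.SCC T π s)) u v := by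
      clear hv
      unfold MDP.Reach at hr
      induction hr with
      | refl => exact ⟨hu, Relation.ReflTransGen.refl⟩
      | tail _ hstep ih =>
        obtain ⟨_, α, hα, hp⟩ := hstep
        exact ⟨hcl _ ih.1 α hα _ hp, Relation.ReflTransGen.tail ih.2 ⟨ih.1, α, ⟨hα, ih.1⟩, hp⟩⟩
    exact key.2
  · intro T' π' h' hi
    have hsT' : s ∈ T' := hi.1 hsC
    obtain ⟨T'', π'', hm, hs'', hi2⟩ := exists_mec_aux M s T' π' h' hsT'
    have hi3 := hclosed s hs T'' π'' hm hs''
    have hi4 : SubMDPIncl T' π' T π :=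
      ⟨hi2.1.trans hi3.1, fun u hu => (hi2.2 u hu).trans (hi3.2 u (hi2.1 hu))⟩
    have hTC : T' ⊆ M.SCC T π s := fun u hu =>
      ⟨hi4.1 hu, reach_mono_aux M hi4 (h'.2 s hsT' u hu), reach_mono_aux M hi4 (h'.2 u hu s hsT')⟩
    exact ⟨hTC, fun u hu α hα => ⟨hi4.2 u hu hα, hTC hu⟩⟩
end

section
/- Let M = (S, A, d_init, δ) be an MDP, let (T,π) be a sub-MDP of M, let s ∈ T, and let C_s be the SCC of s in G(T,π). If ROut_{(T,π)}(C_s) = ∅, then (C_s, π|_{C_s}) is an end-component of M. -/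
variable {S A : Type*} [Fintype S] [Nonempty S] [Fintype A]

/-- Let `M` be an MDP, `(T,π)` a sub-MDP of `M`, `s ∈ T`, and `C_s`
the SCC of `s` in `G(T,π)`.  If `ROut_{(T,π)}(C_s) = ∅`, then `(C_s, π|_{C_s})` is
an end-component of `M`. -/
theorem stmt2 (M : MDP S A) (T : Set S) (π : S → Set A)
    (hsub : M.IsSubMDP T π)
    (s : S) (hs : s ∈ T)
    (hrout : M.ROut T π (M.SCC T π s) = ∅) :
    M.IsEC (M.SCC T π s) (restrictTo π (M.SCC T π s)) := by
  have hcl : ∀ u ∈ M.SCC T π s, ∀ α ∈ π u, ∀ t, 0 < M.δ u α t → t ∈ M.SCC T π s := by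
    intro u hu α hα t ht
    by_contra hn
    have hmem : (u, α) ∈ M.ROut T π (M.SCC T π s) :=
      ⟨hu, hα, t, ⟨hsub.2.2 u hu.1 α hα t ht, hn⟩, ht⟩
    rw [hrout] at hmem
    exact hmem
  refine ⟨⟨⟨s, hs, Relation.ReflTransGen.refl, Relation.ReflTransGen.refl⟩, ?_, ?_⟩, ?_⟩
  · intro u hu
    obtain ⟨⟨α, hα⟩, hen⟩ := hsub.2.1 u hu.1
    exact ⟨⟨α, hα, hu⟩, fun β hβ => hen β hβ.1⟩
  · intro u hu α hα t ht
    exact hcl u hu α hα.1 t ht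
  · intro u hu t ht
    have hr : Relation.ReflTransGen (M.Step T π) u t :=
      Relation.ReflTransGen.trans hu.2.2 ht.2.1
    clear ht
    have key : t ∈ M.SCC T π s ∧
        M.Reach (M.SCC T π s) (restrictTo π (M.SCC T π s)) u t := by
      induction hr with
      | refl => exact ⟨hu, Relation.ReflTransGen.refl⟩
      | tail _ hstep ih =>
        obtain ⟨_, α, hα, hpos⟩ := hstep
        exact ⟨hcl _ ih.1 α hα _ hpos,
          Relation.ReflTransGen.tail ih.2 ⟨ih.1, α, ⟨hα, ih.1⟩, hpos⟩⟩
    exact key.2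
end

section
/- Let M = (S, A, d_init, δ) be an MDP, let (T,π) be an MEC-closed sub-MDP of M, let s ∈ T, and let C_s be the SCC of s in G(T,π). If MEC_M(s) = (T',π') exists, then T' ⊆ C_s and π'(t) ⊆ π(t) for every t ∈ T'. -/
variable {S A : Type*} [Fintype S] [Nonempty S] [Fintype A]

/-- Let `M` be an MDP, `(T,π)` an MEC-closed sub-MDP of `M`, `s ∈ T`,
and `C_s` the SCC of `s` in `G(T,π)`.  If `MEC_M(s) = (T',π')` exists, then
`T' ⊆ C_s` and `π' t ⊆ π t` for every `t ∈ T'`. -/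
theorem stmt3 (M : MDP S A) (T : Set S) (π : S → Set A)
    (hsub : M.IsSubMDP T π) (hclosed : M.MECClosed T π)
    (s : S) (hs : s ∈ T) :
    ∀ T' π', M.IsMEC T' π' → s ∈ T' →
      T' ⊆ M.SCC T π s ∧ ∀ t ∈ T', π' t ⊆ π t := by
  intro T' π' hM hsT
  have hinc := hclosed s hs T' π' hM hsT
  have mono : ∀ a b, M.Reach T' π' a b → M.Reach T π a b := by
    intro a b h
    refine Relation.ReflTransGen.mono ?_ _ _ h
    rintro x y ⟨hx, α, hα, hp⟩
    exact ⟨hinc.1 hx, α, hinc.2 x hx hα, hp⟩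
  refine ⟨fun t ht => ⟨hinc.1 ht, mono _ _ (hM.1.2 s hsT t ht), mono _ _ (hM.1.2 t ht s hsT)⟩, hinc.2⟩
end

section
/- Let M = (S, A, d_init, δ) be an MDP and let (T,π) be an MEC-closed sub-MDP of M. Let X ⊆ sa(T,π) be a set of state-action pairs such that sa(T',π') ∩ X = ∅ for every MEC (T',π') of M. If Attr_{(T,π)}(X) = (S', X'), then for every MEC (T',π') of M it holds that T' ∩ S' = ∅ and sa(T',π') ∩ X' = ∅. -/
variable {S A : Type*} [Fintype S] [Nonempty S] [Fintype A]

/-- Let `M` be an MDP, `(T,π)` an MEC-closed sub-MDP of `M`, and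
`X ⊆ sa(T,π)` a state-action pair set with `sa(T',π') ∩ X = ∅` for every MEC
`(T',π')` of `M`.  If `Attr_{(T,π)}(X) = (S', X')`, then for every MEC `(T',π')`
of `M`, `T' ∩ S' = ∅` and `sa(T',π') ∩ X' = ∅`. -/
theorem stmt4 (M : MDP S A) (T : Set S) (π : S → Set A)
    (hsub : M.IsSubMDP T π) (hclosed : M.MECClosed T π)
    (X : Set (S × A)) (hX : X ⊆ saSet T π)
    (hdisj : ∀ T' π', M.IsMEC T' π' → saSet T' π' ∩ X = ∅)
    (S' : Set S) (X' : Set (S × A)) (hattr : (S', X') = M.Attr T π X) :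
    ∀ T' π', M.IsMEC T' π' →
      T' ∩ S' = ∅ ∧ saSet T' π' ∩ X' = ∅ := by
  intro T' π' hM
  have key : ∀ n, (∀ s ∈ T', s ∉ (M.AttrSeq T π X n).1) ∧
      (∀ s ∈ T', ∀ α ∈ π' s, (s, α) ∉ (M.AttrSeq T π X n).2) := by
    have step : ∀ Y : Set (S × A), (∀ s ∈ T', ∀ α ∈ π' s, (s, α) ∉ Y) →
        ∀ s ∈ T', ¬ (s ∈ T ∧ ∀ α ∈ π s, (s, α) ∈ Y) := by
      rintro Y hY s hs ⟨hsT, hall⟩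
      obtain ⟨α, hα⟩ := (hM.1.1.2.1 s hs).1
      exact hY s hs α hα (hall α ((hclosed s hsT T' π' hM hs).2 s hs hα))
    intro n
    induction n with
    | zero =>
      have h0 : ∀ s ∈ T', ∀ α ∈ π' s, (s, α) ∉ X := by
        intro s hs α hα hx
        have : (s, α) ∈ saSet T' π' ∩ X := ⟨⟨hs, hα⟩, hx⟩
        rw [hdisj T' π' hM] at this
        exact this
      exact ⟨step X h0, h0⟩
    | succ n ih =>
      have h1 : ∀ s ∈ T', ∀ α ∈ π' s, (s, α) ∉ (M.AttrSeq T π X (n + 1)).2 := by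
        rintro s hs α hα (h | ⟨_, t, ht, hδ⟩)
        · exact ih.2 s hs α hα h
        · exact ih.1 t (hM.1.1.2.2 s hs α hα t hδ) ht
      refine ⟨?_, h1⟩
      rintro s hs (h | h)
      · exact ih.1 s hs h
      · exact step _ h1 s hs h
  obtain ⟨rfl, rfl⟩ := Prod.mk.inj hattr
  constructor
  · rw [Set.eq_empty_iff_forall_notMem]
    rintro s ⟨hs, h⟩
    obtain ⟨n, hn⟩ := Set.mem_iUnion.1 h
    exact (key n).1 s hs hn
  · rw [Set.eq_empty_iff_forall_notMem]
    rintro ⟨s, α⟩ ⟨⟨hs, hα⟩, h⟩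
    obtain ⟨n, hn⟩ := Set.mem_iUnion.1 h
    exact (key n).2 s hs α hα hn
end

section
/- Let M = (S, A, d_init, δ) be an MDP, let (T,π) be an MEC-closed sub-MDP of M, let s ∈ T, and let C_s be the SCC of s in G(T,π). Then for every MEC (T',π') of M, sa(T',π') ∩ ROut_{(T,π)}(C_s) = ∅. -/
variable {S A : Type*} [Fintype S] [Nonempty S] [Fintype A]

/-- Let `M` be an MDP, `(T,π)` an MEC-closed sub-MDP of `M`, `s ∈ T`,
and `C_s` the SCC of `s` in `G(T,π)`.  Then for every MEC `(T',π')` of `M`,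
`sa(T',π') ∩ ROut_{(T,π)}(C_s) = ∅`. -/
theorem stmt5 (M : MDP S A) (T : Set S) (π : S → Set A)
    (hsub : M.IsSubMDP T π) (hclosed : M.MECClosed T π)
    (s : S) (hs : s ∈ T) :
    ∀ T' π', M.IsMEC T' π' →
      saSet T' π' ∩ M.ROut T π (M.SCC T π s) = ∅ := by
  intro T' π' hM
  rw [Set.eq_empty_iff_forall_notMem]
  rintro ⟨u, α⟩ ⟨⟨huT', hα'⟩, ⟨huT, hsu, hus⟩, hα, t, ⟨htT, htC⟩, hpos⟩
  have hincl := hclosed u huT T' π' hM huT'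
  have htT' : t ∈ T' := hM.1.1.2.2 u huT' α hα' t hpos
  have hr : M.Reach T π t u :=
    Relation.ReflTransGen.lift (p := M.Step T π) id
      (fun a b (h : M.Step T' π' a b) => by
        obtain ⟨ha, β, hβ, hp⟩ := h
        exact ⟨hincl.1 ha, β, hincl.2 a ha hβ, hp⟩)
      _ _ (hM.1.2 t htT' u huT')
  exact htC ⟨htT, Relation.ReflTransGen.tail hsu ⟨huT, α, hα, hpos⟩,
    Relation.ReflTransGen.trans hr hus⟩
end

section
/- Let M = (S, A, d_init, δ) be an MDP, let (T,π) be an MEC-closed sub-MDP of M, let s ∈ T, let C_s be the SCC of s in G(T,π), and let (U1, X1) = Attr_{(T,π)}(ROut_{(T,π)}(C_s)). Then for every MEC (T',π') of M it holds that T' ∩ U1 = ∅ and sa(T',π') ∩ X1 = ∅. -/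
variable {S A : Type*} [Fintype S] [Nonempty S] [Fintype A]

theorem MDP.attrSeq_disj (M : MDP S A) (T : Set S) (π : S → Set A)
    (s : S) (T' : Set S) (π' : S → Set A) (hT : T' ⊆ T) (hπ : ∀ u ∈ T', π' u ⊆ π u)
    (hec : M.IsEC T' π') (n : ℕ) :
    (∀ u ∈ T', u ∉ (M.AttrSeq T π (M.ROut T π (M.SCC T π s)) n).1) ∧
    (∀ u ∈ T', ∀ α ∈ π' u, (u, α) ∉ (M.AttrSeq T π (M.ROut T π (M.SCC T π s)) n).2) := by
  obtain ⟨⟨_, hne, hcl⟩, hr⟩ := hec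
  have hreach : ∀ u ∈ T', ∀ v ∈ T', M.Reach T π u v := by
    intro u hu v hv
    refine Relation.ReflTransGen.mono ?_ _ _ (hr u hu v hv)
    rintro a b ⟨ha, α, hα, h⟩
    exact ⟨hT ha, α, hπ a ha hα, h⟩
  have key : ∀ X : Set (S × A), (∀ u ∈ T', ∀ α ∈ π' u, (u, α) ∉ X) →
      ∀ u ∈ T', ¬ ∀ α ∈ π u, (u, α) ∈ X := by
    intro X hX u hu h
    obtain ⟨α, hα⟩ := (hne u hu).1
    exact hX u hu α hα (h α (hπ u hu hα))
  induction n with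
  | zero =>
    have h0 : ∀ u ∈ T', ∀ α ∈ π' u, (u, α) ∉ M.ROut T π (M.SCC T π s) := by
      rintro u hu α hα ⟨hC, _, t, ⟨htT, htC⟩, hδ⟩
      have ht : t ∈ T' := hcl u hu α hα t hδ
      exact htC ⟨htT, hC.2.1.trans (hreach u hu t ht), (hreach t ht u hu).trans hC.2.2⟩
    exact ⟨fun u hu h => key _ h0 u hu h.2, h0⟩
  | succ n ih =>
    have h1 : ∀ u ∈ T', ∀ α ∈ π' u,
        (u, α) ∉ (M.AttrSeq T π (M.ROut T π (M.SCC T π s)) (n + 1)).2 := by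
      rintro u hu α hα (h | ⟨_, t, ht, hδ⟩)
      · exact ih.2 u hu α hα h
      · exact ih.1 t (hcl u hu α hα t hδ) ht
    refine ⟨?_, h1⟩
    rintro u hu (h | h)
    · exact ih.1 u hu h
    · exact key _ h1 u hu h.2

theorem MDP.attrSeq_sub (M : MDP S A) (T : Set S) (π : S → Set A) (s : S) (n : ℕ) :
    (∀ u ∈ (M.AttrSeq T π (M.ROut T π (M.SCC T π s)) n).1, u ∈ T) ∧
    (∀ p ∈ (M.AttrSeq T π (M.ROut T π (M.SCC T π s)) n).2, p.1 ∈ T) := by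
  induction n with
  | zero => exact ⟨fun u h => h.1, fun p h => h.1.1⟩
  | succ n ih =>
    constructor
    · rintro u (h | h)
      · exact ih.1 u h
      · exact h.1
    · rintro p (h | h)
      · exact ih.2 p h
      · exact h.1.1

/-- Let `M` be an MDP, `(T,π)` an MEC-closed sub-MDP of `M`, `s ∈ T`,
`C_s` the SCC of `s` in `G(T,π)`, and `(U1, X1) = Attr_{(T,π)}(ROut_{(T,π)}(C_s))`.
Then for every MEC `(T',π')` of `M`, `T' ∩ U1 = ∅` and `sa(T',π') ∩ X1 = ∅`. -/
theorem stmt6 (M : MDP S A) (T : Set S) (π : S → Set A)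
    (hsub : M.IsSubMDP T π) (hclosed : M.MECClosed T π)
    (s : S) (hs : s ∈ T)
    (U1 : Set S) (X1 : Set (S × A))
    (hattr : (U1, X1) = M.Attr T π (M.ROut T π (M.SCC T π s))) :
    ∀ T' π', M.IsMEC T' π' →
      T' ∩ U1 = ∅ ∧ saSet T' π' ∩ X1 = ∅ := by
  obtain ⟨rfl, rfl⟩ := Prod.mk.inj hattr
  intro T' π' hM
  constructor
  · refine Set.eq_empty_of_forall_notMem ?_
    rintro u ⟨hu, hU⟩
    obtain ⟨n, hn⟩ := Set.mem_iUnion.1 hU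
    have hi := hclosed u ((M.attrSeq_sub T π s n).1 u hn) T' π' hM hu
    exact (M.attrSeq_disj T π s T' π' hi.1 hi.2 hM.1 n).1 u hu hn
  · refine Set.eq_empty_of_forall_notMem ?_
    rintro ⟨u, α⟩ ⟨⟨hu, hα⟩, hU⟩
    obtain ⟨n, hn⟩ := Set.mem_iUnion.1 hU
    have hi := hclosed u ((M.attrSeq_sub T π s n).2 _ hn) T' π' hM hu
    exact (M.attrSeq_disj T π s T' π' hi.1 hi.2 hM.1 n).2 u hu α hα hn
end

section
/- Let M = (S, A, d_init, δ) be an MDP, let (T,π) be an MEC-closed sub-MDP of M, let s ∈ T, and let F_s be the forward-reachable set of s in G(T,π). Then for every MEC (T',π') of M, sa(T',π') ∩ ROut_{(T,π)}(T \ F_s) = ∅. -/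
variable {S A : Type*} [Fintype S] [Nonempty S] [Fintype A]

/-- Let `M` be an MDP, `(T,π)` an MEC-closed sub-MDP of `M`, `s ∈ T`,
and `F_s` the forward-reachable set of `s` in `G(T,π)`.  Then for every MEC
`(T',π')` of `M`, `sa(T',π') ∩ ROut_{(T,π)}(T \ F_s) = ∅`. -/
theorem stmt8 (M : MDP S A) (T : Set S) (π : S → Set A)
    (hsub : M.IsSubMDP T π) (hclosed : M.MECClosed T π)
    (s : S) (hs : s ∈ T) :
    ∀ T' π', M.IsMEC T' π' →
      saSet T' π' ∩ M.ROut T π (T \ M.Fwd T π s) = ∅ := by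
  intro T' π' hM
  rw [Set.eq_empty_iff_forall_notMem]
  rintro ⟨u, α⟩ ⟨⟨hu', hα'⟩, ⟨huT, huF⟩, hα, t, ⟨htT, htU⟩, hδ⟩
  simp only at hu' hα' huT huF hα hδ
  obtain ⟨hT, hπ⟩ := hclosed u huT T' π' hM hu'
  have htF : t ∈ M.Fwd T π s := by
    by_contra h
    exact htU ⟨htT, h⟩
  have ht' : t ∈ T' := hM.1.1.2.2 u hu' α hα' t hδ
  have hr : M.Reach T' π' t u := hM.1.2 t ht' u hu'
  have hr2 : M.Reach T π t u := by
    refine Relation.ReflTransGen.mono ?_ _ _ hr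
    rintro a b ⟨ha, β, hβ, hb⟩
    exact ⟨hT ha, β, hπ a ha hβ, hb⟩
  exact huF ⟨huT, Relation.ReflTransGen.trans htF.2 hr2⟩
end

section
/- Let M = (S, A, d_init, δ) be an MDP, let (T,π) be an MEC-closed sub-MDP of M, let s ∈ T, let F_s be the forward-reachable set of s in G(T,π), and let (U3, X3) = Attr_{(T,π)}(ROut_{(T,π)}(T \ F_s)). Then for every MEC (T',π') of M it holds that T' ∩ U3 = ∅ and sa(T',π') ∩ X3 = ∅. -/
variable {S A : Type*} [Fintype S] [Nonempty S] [Fintype A]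

/-- Let `M` be an MDP, `(T,π)` an MEC-closed sub-MDP of `M`, `s ∈ T`,
`F_s` the forward-reachable set of `s` in `G(T,π)`, and
`(U3, X3) = Attr_{(T,π)}(ROut_{(T,π)}(T \ F_s))`.  Then for every MEC `(T',π')`
of `M`, `T' ∩ U3 = ∅` and `sa(T',π') ∩ X3 = ∅`. -/
theorem stmt9 (M : MDP S A) (T : Set S) (π : S → Set A)
    (hsub : M.IsSubMDP T π) (hclosed : M.MECClosed T π)
    (s : S) (hs : s ∈ T)
    (U3 : Set S) (X3 : Set (S × A))
    (hattr : (U3, X3) = M.Attr T π (M.ROut T π (T \ M.Fwd T π s))) :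
    ∀ T' π', M.IsMEC T' π' →
      T' ∩ U3 = ∅ ∧ saSet T' π' ∩ X3 = ∅ := by
  intro T' π' hM
  obtain ⟨rfl, rfl⟩ := Prod.mk.inj hattr
  obtain ⟨⟨⟨_, hne, hcl⟩, hconn⟩, _⟩ := id hM
  have hS : ∀ (X : Set (S × A)), (∀ p ∈ saSet T' π', p ∉ X) →
      ∀ t ∈ T', ¬ (t ∈ T ∧ ∀ α ∈ π t, (t, α) ∈ X) := by
    rintro X hX t ht ⟨htT, hall⟩
    obtain ⟨α, hα⟩ := (hne t ht).1
    exact hX (t, α) ⟨ht, hα⟩ (hall α ((hclosed t htT T' π' hM ht).2 t ht hα))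
  have key : ∀ n, (∀ t ∈ T', t ∉ (M.AttrSeq T π (M.ROut T π (T \ M.Fwd T π s)) n).1) ∧
      (∀ p ∈ saSet T' π', p ∉ (M.AttrSeq T π (M.ROut T π (T \ M.Fwd T π s)) n).2) := by
    intro n
    induction n with
    | zero =>
      have h0 : ∀ p ∈ saSet T' π', p ∉ M.ROut T π (T \ M.Fwd T π s) := by
        rintro ⟨t, α⟩ ⟨ht, hα⟩ ⟨⟨htT, htF⟩, _, u, ⟨huT, huF⟩, hδ⟩
        have huF' : u ∈ M.Fwd T π s := by
          by_contra h
          exact huF ⟨huT, h⟩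
        have hinc := hclosed t htT T' π' hM ht
        have hr : M.Reach T' π' u t := hconn u (hcl t ht α hα u hδ) t ht
        have hr' : M.Reach T π u t := by
          refine Relation.ReflTransGen.mono ?_ _ _ hr
          rintro a b ⟨ha, β, hβ, hab⟩
          exact ⟨hinc.1 ha, β, hinc.2 a ha hβ, hab⟩
        exact htF ⟨htT, Relation.ReflTransGen.trans huF'.2 hr'⟩
      exact ⟨hS _ h0, h0⟩
    | succ n ih =>
      obtain ⟨ih1, ih2⟩ := ih
      have hX : ∀ p ∈ saSet T' π',
          p ∉ (M.AttrSeq T π (M.ROut T π (T \ M.Fwd T π s)) (n + 1)).2 := by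
        rintro p hp (h | ⟨_, u, hu, hδ⟩)
        · exact ih2 p hp h
        · exact ih1 u (hcl p.1 hp.1 p.2 hp.2 u hδ) hu
      refine ⟨?_, hX⟩
      rintro t ht (h | h)
      · exact ih1 t ht h
      · exact hS _ hX t ht h
  constructor
  · ext t
    simp only [Set.mem_inter_iff, Set.mem_empty_iff_false, iff_false, not_and]
    intro ht h
    obtain ⟨n, hn⟩ := Set.mem_iUnion.1 h
    exact (key n).1 t ht hn
  · ext p
    simp only [Set.mem_inter_iff, Set.mem_empty_iff_false, iff_false, not_and]
    intro ht h
    obtain ⟨n, hn⟩ := Set.mem_iUnion.1 h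
    exact (key n).2 p ht hn
end

section
/- Let M = (S, A, d_init, δ) be an MDP, let (T,π) be an MEC-closed sub-MDP of M, let s ∈ T, let C_s be the SCC of s in G(T,π), and let (U1, X1) = Attr_{(T,π)}(ROut_{(T,π)}(C_s)). Suppose X1 ≠ ∅ and V1 = C_s \ U1 ≠ ∅. Define π1 : V1 → 2^A by π1(v) = {α ∈ π(v) | (v,α) ∉ X1 and ∃ u ∈ V1 with δ(v,α,u) > 0}. Then (V1, π1) is an MEC-closed sub-MDP of M. -/
variable {S A : Type*} [Fintype S] [Nonempty S] [Fintype A]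

/-- Let `M` be an MDP, `(T,π)` an MEC-closed sub-MDP of `M`, `s ∈ T`,
`C_s` the SCC of `s` in `G(T,π)`, and `(U1, X1) = Attr_{(T,π)}(ROut_{(T,π)}(C_s))`.
Suppose `X1 ≠ ∅` and `V1 = C_s \ U1 ≠ ∅`, and define
`π1 v = {α ∈ π v | (v,α) ∉ X1 ∧ ∃ u ∈ V1, δ v α u > 0}`.
Then `(V1, π1)` is an MEC-closed sub-MDP of `M`. -/
theorem stmt10 (M : MDP S A) (T : Set S) (π : S → Set A)
    (hsub : M.IsSubMDP T π) (hclosed : M.MECClosed T π)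
    (s : S) (hs : s ∈ T)
    (U1 : Set S) (X1 : Set (S × A))
    (hattr : (U1, X1) = M.Attr T π (M.ROut T π (M.SCC T π s)))
    (hX1 : X1 ≠ ∅)
    (V1 : Set S) (hV1 : V1 = M.SCC T π s \ U1) (hV1ne : V1 ≠ ∅)
    (π1 : S → Set A)
    (hπ1 : ∀ v, π1 v = {α ∈ π v | (v, α) ∉ X1 ∧ ∃ u ∈ V1, 0 < M.δ v α u}) :
    M.IsSubMDP V1 π1 ∧ M.MECClosed V1 π1 := by
  obtain ⟨hU, hX⟩ := Prod.mk.inj hattr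
  obtain ⟨hTne, hen, hcl⟩ := hsub
  set C := M.SCC T π s with hC
  set R := M.ROut T π C with hR
  have hmono : Monotone (fun n => (M.AttrSeq T π R n).2) :=
    monotone_nat_of_le_succ (fun n => by
      intro p hp
      exact Or.inl hp)
  have hSX : ∀ n v, v ∈ T → (∀ α ∈ π v, (v, α) ∈ (M.AttrSeq T π R n).2) →
      v ∈ (M.AttrSeq T π R n).1 := by
    intro n v hv h
    cases n with
    | zero => exact ⟨hv, h⟩
    | succ n => exact Or.inr ⟨hv, h⟩
  have hVT : ∀ v ∈ V1, v ∈ T := by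
    intro v hv
    rw [hV1] at hv
    exact hv.1.1
  -- successors of pairs outside `X1` stay in `V1`
  have hstay : ∀ v ∈ V1, ∀ α ∈ π v, (v, α) ∉ X1 → ∀ t, 0 < M.δ v α t → t ∈ V1 := by
    intro v hv α hα hnX t ht
    have hvT := hVT v hv
    have htT := hcl v hvT α hα t ht
    rw [hV1] at hv ⊢
    refine ⟨?_, ?_⟩
    · by_contra htC
      apply hnX
      rw [hX]
      exact Set.mem_iUnion.2 ⟨0, hv.1, hα, t, ⟨htT, htC⟩, ht⟩
    · intro htU
      apply hnX
      rw [hU] at htU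
      obtain ⟨n, hn⟩ := Set.mem_iUnion.1 htU
      rw [hX]
      exact Set.mem_iUnion.2 ⟨n + 1, Or.inr ⟨⟨hvT, hα⟩, t, hn, ht⟩⟩
  have hpos : ∀ v α, M.Enabled v α → ∃ t, 0 < M.δ v α t := by
    intro v α h
    by_contra hno
    push Not at hno
    have h0 : (∑ t, M.δ v α t) ≤ 0 := Finset.sum_nonpos (fun t _ => hno t)
    unfold MDP.Enabled at h
    linarith
  refine ⟨⟨Set.nonempty_iff_ne_empty.2 hV1ne, ?_, ?_⟩, ?_⟩
  · intro v hv
    have hvT := hVT v hv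
    refine ⟨?_, ?_⟩
    · have hex : ∃ α ∈ π v, (v, α) ∉ X1 := by
        by_contra hno
        push Not at hno
        have hall : ∀ α, ∃ n, α ∈ π v → (v, α) ∈ (M.AttrSeq T π R n).2 := by
          intro α
          by_cases hα : α ∈ π v
          · have h := hno α hα
            rw [hX] at h
            obtain ⟨n, hn⟩ := Set.mem_iUnion.1 h
            exact ⟨n, fun _ => hn⟩
          · exact ⟨0, fun h => absurd h hα⟩
        choose f hf using hall
        have hin := hSX (Finset.univ.sup f) v hvT (fun α hα =>
          hmono (Finset.le_sup (Finset.mem_univ α)) (hf α hα))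
        rw [hV1] at hv
        apply hv.2
        rw [hU]
        exact Set.mem_iUnion.2 ⟨_, hin⟩
      obtain ⟨α, hα, hnX⟩ := hex
      obtain ⟨t, ht⟩ := hpos v α ((hen v hvT).2 α hα)
      refine ⟨α, ?_⟩
      rw [hπ1]
      exact ⟨hα, hnX, t, hstay v hv α hα hnX t ht, ht⟩
    · intro α hα
      rw [hπ1] at hα
      exact (hen v hvT).2 α hα.1
  · intro v hv α hα t ht
    rw [hπ1] at hα
    exact hstay v hv α hα.1 hα.2.1 t ht
  · intro v hv T' π' hmec hvT'
    have hvT := hVT v hv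
    obtain ⟨hTT, hππ⟩ := hclosed v hvT T' π' hmec hvT'
    obtain ⟨⟨⟨_, hen', hcl'⟩, hreach⟩, _⟩ := hmec
    have hlift : ∀ a b, M.Reach T' π' a b → M.Reach T π a b := by
      intro a b h
      refine Relation.ReflTransGen.mono ?_ a b h
      rintro x y ⟨hx, α, hα, hd⟩
      exact ⟨hTT hx, α, hππ x hx hα, hd⟩
    have hvC : v ∈ C := by
      rw [hV1] at hv
      exact hv.1
    have hTC : ∀ t ∈ T', t ∈ C := fun t ht =>
      ⟨hTT ht, hvC.2.1.trans (hlift _ _ (hreach v hvT' t ht)),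
        (hlift _ _ (hreach t ht v hvT')).trans hvC.2.2⟩
    have hS_of_X : ∀ Y : Set (S × A), (∀ t ∈ T', ∀ α ∈ π' t, (t, α) ∉ Y) →
        ∀ t ∈ T', ¬ (∀ α ∈ π t, (t, α) ∈ Y) := by
      intro Y hY t ht h
      obtain ⟨α, hα⟩ := (hen' t ht).1
      exact hY t ht α hα (h α (hππ t ht hα))
    have hdis : ∀ n, (∀ t ∈ T', t ∉ (M.AttrSeq T π R n).1) ∧
        (∀ t ∈ T', ∀ α ∈ π' t, (t, α) ∉ (M.AttrSeq T π R n).2) := by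
      intro n
      induction n with
      | zero =>
        have h2 : ∀ t ∈ T', ∀ α ∈ π' t, (t, α) ∉ R := by
          rintro t ht α hα ⟨_, _, u, ⟨_, hu⟩, hd⟩
          exact hu (hTC u (hcl' t ht α hα u hd))
        exact ⟨fun t ht h => hS_of_X R h2 t ht h.2, h2⟩
      | succ n ih =>
        have h2 : ∀ t ∈ T', ∀ α ∈ π' t, (t, α) ∉ (M.AttrSeq T π R (n + 1)).2 := by
          rintro t ht α hα (h | ⟨_, u, hu, hd⟩)
          · exact ih.2 t ht α hα h
          · exact ih.1 u (hcl' t ht α hα u hd) hu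
        refine ⟨?_, h2⟩
        rintro t ht (h | h)
        · exact ih.1 t ht h
        · exact hS_of_X _ h2 t ht h.2
    have hTV : ∀ t ∈ T', t ∈ V1 := by
      intro t ht
      rw [hV1]
      refine ⟨hTC t ht, fun h => ?_⟩
      rw [hU] at h
      obtain ⟨n, hn⟩ := Set.mem_iUnion.1 h
      exact (hdis n).1 t ht hn
    refine ⟨hTV, fun t ht α hα => ?_⟩
    obtain ⟨u, hu⟩ := hpos t α ((hen' t ht).2 α hα)
    rw [hπ1]
    refine ⟨hππ t ht hα, fun h => ?_, u, hTV u (hcl' t ht α hα u hu), hu⟩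
    rw [hX] at h
    obtain ⟨n, hn⟩ := Set.mem_iUnion.1 h
    exact (hdis n).2 t ht α hα hn
end

section
/- Let M = (S, A, d_init, δ) be an MDP, let (T,π) be an MEC-closed sub-MDP of M, let s ∈ T, let F_s be the forward-reachable set of s in G(T,π), and let C_s be the SCC of s in G(T,π). Suppose V2 = F_s \ C_s ≠ ∅. Define π2 : V2 → 2^A by π2(v) = {α ∈ π(v) | ∃ u ∈ V2 with δ(v,α,u) > 0}. Then (V2, π2) is an MEC-closed sub-MDP of M. -/
variable {S A : Type*} [Fintype S] [Nonempty S] [Fintype A]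

/-- Let `M` be an MDP, `(T,π)` an MEC-closed sub-MDP of `M`, `s ∈ T`,
`F_s` the forward-reachable set of `s` and `C_s` the SCC of `s` in `G(T,π)`.
Suppose `V2 = F_s \ C_s ≠ ∅`, and define `π2 v = {α ∈ π v | ∃ u ∈ V2, δ v α u > 0}`.
Then `(V2, π2)` is an MEC-closed sub-MDP of `M`. -/
theorem stmt11 (M : MDP S A) (T : Set S) (π : S → Set A)
    (hsub : M.IsSubMDP T π) (hclosed : M.MECClosed T π)
    (s : S) (hs : s ∈ T)
    (V2 : Set S) (hV2 : V2 = M.Fwd T π s \ M.SCC T π s) (hV2ne : V2 ≠ ∅)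
    (π2 : S → Set A)
    (hπ2 : ∀ v, π2 v = {α ∈ π v | ∃ u ∈ V2, 0 < M.δ v α u}) :
    M.IsSubMDP V2 π2 ∧ M.MECClosed V2 π2 := by
  subst hV2
  obtain ⟨_, hact, hcl⟩ := hsub
  have hstep : ∀ v ∈ M.Fwd T π s \ M.SCC T π s, ∀ t, M.Step T π v t →
      t ∈ M.Fwd T π s \ M.SCC T π s := by
    rintro v ⟨⟨hvT, hsv⟩, hvC⟩ t hst
    have htT : t ∈ T := by
      obtain ⟨_, α, hα, hpos⟩ := hst
      exact hcl v hvT α hα t hpos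
    refine ⟨⟨htT, Relation.ReflTransGen.tail hsv hst⟩, fun htC => hvC ⟨hvT, hsv, ?_⟩⟩
    exact Relation.ReflTransGen.head hst htC.2.2
  have hsame : ∀ v ∈ M.Fwd T π s \ M.SCC T π s, ∀ α, α ∈ π v → α ∈ π2 v := by
    intro v hv α hα
    rw [hπ2]
    refine ⟨hα, ?_⟩
    have hen : (∑ t, M.δ v α t) = 1 := (hact v hv.1.1).2 α hα
    have hex : ∃ t ∈ Finset.univ, 0 < M.δ v α t := by
      by_contra hcon
      push Not at hcon
      have := Finset.sum_nonpos hcon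
      linarith
    obtain ⟨t, _, ht⟩ := hex
    exact ⟨t, hstep v hv t ⟨hv.1.1, α, hα, ht⟩, ht⟩
  have hsub2 : ∀ v α, α ∈ π2 v → α ∈ π v := by
    intro v α hα
    rw [hπ2] at hα
    exact hα.1
  refine ⟨⟨Set.nonempty_iff_ne_empty.mpr hV2ne, ?_, ?_⟩, ?_⟩
  · intro v hv
    obtain ⟨⟨α, hα⟩, hen⟩ := hact v hv.1.1
    exact ⟨⟨α, hsame v hv α hα⟩, fun β hβ => hen β (hsub2 v β hβ)⟩
  · intro v hv α hα t ht
    exact hstep v hv t ⟨hv.1.1, α, hsub2 v α hα, ht⟩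
  · intro v hv T' π' hmec hvT'
    obtain ⟨hT, hπ⟩ := hclosed v hv.1.1 T' π' hmec hvT'
    have hin : T' ⊆ M.Fwd T π s \ M.SCC T π s := by
      intro t ht
      have hr : Relation.ReflTransGen (M.Step T' π') v t := hmec.1.2 v hvT' t ht
      clear ht
      induction hr with
      | refl => exact hv
      | tail _ hst ih =>
        obtain ⟨hb, α, hα, hpos⟩ := hst
        exact hstep _ ih _ ⟨hT hb, α, hπ _ hb hα, hpos⟩
    exact ⟨hin, fun u hu α hα => hsame u (hin hu) α (hπ u hu hα)⟩
end

section
/- Let M = (S, A, d_init, δ) be an MDP, let (T,π) be an MEC-closed sub-MDP of M, let s ∈ T, let F_s be the forward-reachable set of s in G(T,π), and let (U3, X3) = Attr_{(T,π)}(ROut_{(T,π)}(T \ F_s)). Suppose V3 = (T \ F_s) \ U3 ≠ ∅. Define π3 : V3 → 2^A by π3(v) = {α ∈ π(v) | (v,α) ∉ X3 and ∃ u ∈ V3 with δ(v,α,u) > 0}. Then (V3, π3) is an MEC-closed sub-MDP of M. -/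
variable {S A : Type*} [Fintype S] [Nonempty S] [Fintype A]

theorem attr_mono (M : MDP S A) (T : Set S) (π : S → Set A) (X : Set (S × A)) :
    Monotone (fun n => (M.AttrSeq T π X n).2) := by
  refine monotone_nat_of_le_succ fun n p hp => ?_
  exact Or.inl hp

theorem attr_S_mem (M : MDP S A) (T : Set S) (π : S → Set A) (X : Set (S × A)) (n : ℕ)
    (u : S) (hu : u ∈ (M.AttrSeq T π X n).1) :
    ∀ α ∈ π u, (u, α) ∈ (M.AttrSeq T π X n).2 := by
  induction n with
  | zero => exact hu.2
  | succ n ih =>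
    rcases hu with hu | hu
    · intro α hα
      exact Or.inl (ih hu α hα)
    · exact hu.2

theorem attr_close (M : MDP S A) (T : Set S) (π : S → Set A) (X : Set (S × A))
    (u : S) (hu : u ∈ T) (h : ∀ α ∈ π u, (u, α) ∈ (M.Attr T π X).2) :
    u ∈ (M.Attr T π X).1 := by
  have h1 : ∀ α, ∃ n, α ∈ π u → (u, α) ∈ (M.AttrSeq T π X n).2 := by
    intro α
    by_cases hα : α ∈ π u
    · obtain ⟨n, hn⟩ := Set.mem_iUnion.1 (h α hα)
      exact ⟨n, fun _ => hn⟩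
    · exact ⟨0, fun h => absurd h hα⟩
  choose f hf using h1
  refine Set.mem_iUnion.2 ⟨Finset.univ.sup f + 1, Or.inr ⟨hu, fun α hα => ?_⟩⟩
  exact Or.inl (attr_mono M T π X (Finset.le_sup (Finset.mem_univ α)) (hf α hα))

theorem exists_succ (M : MDP S A) (s : S) (α : A) (h : M.Enabled s α) :
    ∃ t, 0 < M.δ s α t := by
  by_contra! hc
  have : (∑ t, M.δ s α t) ≤ 0 := Finset.sum_nonpos fun t _ => hc t
  unfold MDP.Enabled at h
  linarith

/-- Let `M` be an MDP, `(T,π)` an MEC-closed sub-MDP of `M`, `s ∈ T`,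
`F_s` the forward-reachable set of `s` in `G(T,π)`, and
`(U3, X3) = Attr_{(T,π)}(ROut_{(T,π)}(T \ F_s))`.  Suppose
`V3 = (T \ F_s) \ U3 ≠ ∅`, and define
`π3 v = {α ∈ π v | (v,α) ∉ X3 ∧ ∃ u ∈ V3, δ v α u > 0}`.
Then `(V3, π3)` is an MEC-closed sub-MDP of `M`. -/
theorem stmt12 (M : MDP S A) (T : Set S) (π : S → Set A)
    (hsub : M.IsSubMDP T π) (hclosed : M.MECClosed T π)
    (s : S) (hs : s ∈ T)
    (U3 : Set S) (X3 : Set (S × A))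
    (hattr : (U3, X3) = M.Attr T π (M.ROut T π (T \ M.Fwd T π s)))
    (V3 : Set S) (hV3 : V3 = (T \ M.Fwd T π s) \ U3) (hV3ne : V3 ≠ ∅)
    (π3 : S → Set A)
    (hπ3 : ∀ v, π3 v = {α ∈ π v | (v, α) ∉ X3 ∧ ∃ u ∈ V3, 0 < M.δ v α u}) :
    M.IsSubMDP V3 π3 ∧ M.MECClosed V3 π3 := by
  obtain ⟨rfl, rfl⟩ := Prod.mk.inj hattr
  obtain ⟨hne, hen, hcl⟩ := hsub
  have key : ∀ v ∈ V3, ∀ α ∈ π v,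
      (v, α) ∉ (⋃ n, (M.AttrSeq T π (M.ROut T π (T \ M.Fwd T π s)) n).2) →
      ∀ t, 0 < M.δ v α t → t ∈ V3 := by
    intro v hv α hα hX t ht
    rw [hV3] at hv ⊢
    have htT := hcl v hv.1.1 α hα t ht
    refine ⟨⟨htT, fun hF => hX ?_⟩, fun hU => hX ?_⟩
    · exact Set.mem_iUnion.2 ⟨0, hv.1, hα, t, ⟨htT, fun h => h.2 hF⟩, ht⟩
    · obtain ⟨n, hn⟩ := Set.mem_iUnion.1 hU
      exact Set.mem_iUnion.2 ⟨n + 1, Or.inr ⟨⟨hv.1.1, hα⟩, t, hn, ht⟩⟩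
  have hVT : ∀ v ∈ V3, v ∈ T := fun v hv => by rw [hV3] at hv; exact hv.1.1
  refine ⟨⟨Set.nonempty_iff_ne_empty.2 hV3ne, fun v hv => ⟨?_, ?_⟩, ?_⟩, ?_⟩
  · have hnU : v ∉ (M.Attr T π (M.ROut T π (T \ M.Fwd T π s))).1 := by
      rw [hV3] at hv; exact hv.2
    have : ∃ α ∈ π v, (v, α) ∉ (M.Attr T π (M.ROut T π (T \ M.Fwd T π s))).2 := by
      by_contra! hc
      exact hnU (attr_close M T π _ v (hVT v hv) hc)
    obtain ⟨α, hα, hX⟩ := this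
    obtain ⟨t, ht⟩ := exists_succ M v α ((hen v (hVT v hv)).2 α hα)
    refine ⟨α, ?_⟩
    rw [hπ3]
    exact ⟨hα, hX, t, key v hv α hα hX t ht, ht⟩
  · intro α hα
    rw [hπ3] at hα
    exact (hen v (hVT v hv)).2 α hα.1
  · intro v hv α hα t ht
    rw [hπ3] at hα
    exact key v hv α hα.1 hα.2.1 t ht
  · intro v hv T' π' hM hvT'
    obtain ⟨hTT, hππ⟩ := hclosed v (hVT v hv) T' π' hM hvT'
    obtain ⟨⟨⟨_, hen', hcl'⟩, hconn⟩, _⟩ := hM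
    have hF : ∀ u ∈ T', u ∉ M.Fwd T π s := by
      intro u hu huF
      have h1 : M.Reach T π u v := by
        refine Relation.ReflTransGen.mono ?_ _ _ (hconn u hu v hvT')
        rintro a b ⟨ha, α, hα, hd⟩
        exact ⟨hTT ha, α, hππ a ha hα, hd⟩
      have hv' := hv
      rw [hV3] at hv'
      exact hv'.1.2 ⟨hVT v hv, huF.2.trans h1⟩
    have hX : ∀ n, ∀ u ∈ T', ∀ α ∈ π' u,
        (u, α) ∉ (M.AttrSeq T π (M.ROut T π (T \ M.Fwd T π s)) n).2 := by
      intro n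
      induction n with
      | zero =>
        rintro u hu α hα ⟨_, _, t, ht, hd⟩
        exact ht.2 ⟨ht.1, hF t (hcl' u hu α hα t hd)⟩
      | succ n ih =>
        rintro u hu α hα (h | ⟨_, t, ht, hd⟩)
        · exact ih u hu α hα h
        · have htT' := hcl' u hu α hα t hd
          obtain ⟨β, hβ⟩ := (hen' t htT').1
          exact ih t htT' β hβ (attr_S_mem M T π _ n t ht β (hππ t htT' hβ))
    have hsubV : T' ⊆ V3 := by
      intro u hu
      rw [hV3]
      refine ⟨⟨hTT hu, hF u hu⟩, fun hU => ?_⟩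
      obtain ⟨n, hn⟩ := Set.mem_iUnion.1 hU
      obtain ⟨β, hβ⟩ := (hen' u hu).1
      exact hX n u hu β hβ (attr_S_mem M T π _ n u hn β (hππ u hu hβ))
    refine ⟨hsubV, fun u hu α hα => ?_⟩
    rw [hπ3]
    obtain ⟨t, ht⟩ := exists_succ M u α ((hen' u hu).2 α hα)
    refine ⟨hππ u hu hα, fun h => ?_, t, hsubV (hcl' u hu α hα t ht), ht⟩
    obtain ⟨n, hn⟩ := Set.mem_iUnion.1 h
    exact hX n u hu α hα hn
end

section
/- Let M = (S, A, d_init, δ) be an MDP, let (T,π) be an MEC-closed sub-MDP of M, let s ∈ T, let F_s be the forward-reachable set of s in G(T,π), and let C_s be the SCC of s in G(T,π). Then for every t ∈ T for which MEC_M(t) = (T',π') exists, exactly one of the following holds: T' ⊆ C_s, or T' ⊆ F_s \ C_s, or T' ⊆ T \ F_s. -/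
variable {S A : Type*} [Fintype S] [Nonempty S] [Fintype A]

/-- Let `M` be an MDP, `(T,π)` an MEC-closed sub-MDP of `M`, `s ∈ T`,
`F_s` the forward-reachable set of `s` and `C_s` the SCC of `s` in `G(T,π)`.  Then
for every `t ∈ T` for which `MEC_M(t) = (T',π')` exists, exactly one of the
following holds: `T' ⊆ C_s`, or `T' ⊆ F_s \ C_s`, or `T' ⊆ T \ F_s`. -/
theorem stmt14 (M : MDP S A) (T : Set S) (π : S → Set A)
    (hsub : M.IsSubMDP T π) (hclosed : M.MECClosed T π)
    (s : S) (hs : s ∈ T) :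
    ∀ t ∈ T, ∀ T' π', M.IsMEC T' π' → t ∈ T' →
      (T' ⊆ M.SCC T π s ∧ ¬ T' ⊆ (M.Fwd T π s \ M.SCC T π s) ∧ ¬ T' ⊆ (T \ M.Fwd T π s)) ∨
      (¬ T' ⊆ M.SCC T π s ∧ T' ⊆ (M.Fwd T π s \ M.SCC T π s) ∧ ¬ T' ⊆ (T \ M.Fwd T π s)) ∨
      (¬ T' ⊆ M.SCC T π s ∧ ¬ T' ⊆ (M.Fwd T π s \ M.SCC T π s) ∧ T' ⊆ (T \ M.Fwd T π s)) := by
  intro t ht T' π' hM htT'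
  obtain ⟨hTT, hππ⟩ := hclosed t ht T' π' hM htT'
  have hmono : ∀ a b, M.Reach T' π' a b → M.Reach T π a b := by
    intro a b h
    refine Relation.ReflTransGen.mono ?_ _ _ h
    rintro x y ⟨hx, α, hα, hp⟩
    exact ⟨hTT hx, α, hππ x hx hα, hp⟩
  have hr : ∀ a ∈ T', ∀ b ∈ T', M.Reach T π a b :=
    fun a ha b hb => hmono a b (hM.1.2 a ha b hb)
  have hF : ∀ a ∈ T', (a ∈ M.Fwd T π s ↔ t ∈ M.Fwd T π s) := fun a ha =>
    ⟨fun h => ⟨ht, Relation.ReflTransGen.trans h.2 (hr a ha t htT')⟩,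
     fun h => ⟨hTT ha, Relation.ReflTransGen.trans h.2 (hr t htT' a ha)⟩⟩
  have hC : ∀ a ∈ T', (a ∈ M.SCC T π s ↔ t ∈ M.SCC T π s) := fun a ha =>
    ⟨fun h => ⟨ht, Relation.ReflTransGen.trans h.2.1 (hr a ha t htT'),
        Relation.ReflTransGen.trans (hr t htT' a ha) h.2.2⟩,
     fun h => ⟨hTT ha, Relation.ReflTransGen.trans h.2.1 (hr t htT' a ha),
        Relation.ReflTransGen.trans (hr a ha t htT') h.2.2⟩⟩
  have hCF : t ∈ M.SCC T π s → t ∈ M.Fwd T π s := fun h => ⟨h.1, h.2.1⟩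
  have h1 : T' ⊆ M.SCC T π s ↔ t ∈ M.SCC T π s :=
    ⟨fun h => h htT', fun h a ha => (hC a ha).2 h⟩
  have h2 : T' ⊆ M.Fwd T π s \ M.SCC T π s ↔ (t ∈ M.Fwd T π s ∧ t ∉ M.SCC T π s) :=
    ⟨fun h => h htT', fun h a ha => ⟨(hF a ha).2 h.1, fun h' => h.2 ((hC a ha).1 h')⟩⟩
  have h3 : T' ⊆ T \ M.Fwd T π s ↔ t ∉ M.Fwd T π s :=
    ⟨fun h => (h htT').2, fun h a ha => ⟨hTT ha, fun h' => h ((hF a ha).1 h')⟩⟩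
  rw [h1, h2, h3]
  tauto
end

section
/- Let M = (S, A, d_init, δ) be an MDP, let (T,π) be an MEC-closed sub-MDP of M, let s ∈ T, let F_s be the forward-reachable set of s in G(T,π), let C_s be the SCC of s in G(T,π), let (U1, X1) = Attr_{(T,π)}(ROut_{(T,π)}(C_s)), let (U3, X3) = Attr_{(T,π)}(ROut_{(T,π)}(T \ F_s)), and set V1 = C_s \ U1, V2 = F_s \ C_s, V3 = (T \ F_s) \ U3. For a set of states W, write MECs_M(W) = {MEC_M(t) | t ∈ W and MEC_M(t) exists}. Then: if X1 ≠ ∅, the set of MECs of states in T satisfies MECs_M(T) = MECs_M(V1) ∪ MECs_M(V2) ∪ MECs_M(V3); and if X1 = ∅, then MECs_M(T) = {(C_s, π|_{C_s})} ∪ MECs_M(V2) ∪ MECs_M(V3). -/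
variable {S A : Type*} [Fintype S] [Nonempty S] [Fintype A]

section helpers15
open MDP

theorem h15_reach_mono (M : MDP S A) {T T' : Set S} {π π' : S → Set A}
    (h : SubMDPIncl T' π' T π) {a b : S} (hr : M.Reach T' π' a b) : M.Reach T π a b := by
  refine Relation.ReflTransGen.mono ?_ _ _ hr
  rintro x y ⟨hx, α, hα, hd⟩
  exact ⟨h.1 hx, α, h.2 x hx hα, hd⟩

theorem h15_attr (M : MDP S A) {T T' : Set S} {π π' : S → Set A} (X : Set (S × A))
    (hec : M.IsEC T' π') (h : SubMDPIncl T' π' T π)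
    (hX : ∀ u ∈ T', ∀ α ∈ π' u, (u, α) ∉ X) (n : ℕ) :
    (∀ u ∈ T', u ∉ (M.AttrSeq T π X n).1) ∧
    (∀ u ∈ T', ∀ α ∈ π' u, (u, α) ∉ (M.AttrSeq T π X n).2) := by
  obtain ⟨⟨-, hne, hcl⟩, -⟩ := hec
  induction n with
  | zero =>
    refine ⟨?_, hX⟩
    rintro u hu ⟨-, h2⟩
    obtain ⟨α, hα⟩ := (hne u hu).1
    exact hX u hu α hα (h2 α (h.2 u hu hα))
  | succ n ih =>
    have key : ∀ u ∈ T', ∀ α ∈ π' u, (u, α) ∉ (M.AttrSeq T π X (n+1)).2 := by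
      rintro u hu α hα (h1 | ⟨-, t, ht, hd⟩)
      · exact ih.2 u hu α hα h1
      · exact ih.1 t (hcl u hu α hα t hd) ht
    refine ⟨?_, key⟩
    rintro u hu (h1 | ⟨-, h2⟩)
    · exact ih.1 u hu h1
    · obtain ⟨α, hα⟩ := (hne u hu).1
      exact key u hu α hα (h2 α (h.2 u hu hα))

theorem h15_attr_rout (M : MDP S A) {T T' : Set S} {π π' : S → Set A} (U : Set S)
    (hec : M.IsEC T' π') (h : SubMDPIncl T' π' T π) (hU : T' ⊆ U) :
    ∀ u ∈ T', u ∉ (M.Attr T π (M.ROut T π U)).1 := by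
  intro u hu hmem
  obtain ⟨n, hn⟩ := Set.mem_iUnion.1 hmem
  refine (h15_attr M (M.ROut T π U) hec h ?_ n).1 u hu hn
  rintro v hv α hα ⟨-, -, t, ht, hd⟩
  exact ht.2 (hU (hec.1.2.2 v hv α hα t hd))

theorem h15_exists_mec (M : MDP S A) {T : Set S} {π : S → Set A} (hec : M.IsEC T π) :
    ∃ T' π', M.IsMEC T' π' ∧ SubMDPIncl T π T' π' := by
  have hiff : ∀ (T₁ : Set S) (π₁ : S → Set A) (T₂ : Set S) (π₂ : S → Set A),
      M.IsEC T₁ π₁ → saSet T₁ π₁ ⊆ saSet T₂ π₂ → SubMDPIncl T₁ π₁ T₂ π₂ := by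
    intro T₁ π₁ T₂ π₂ h1 hs
    refine ⟨fun u hu => ?_, fun u hu α hα => (hs (show (u, α) ∈ saSet T₁ π₁ from ⟨hu, hα⟩)).2⟩
    obtain ⟨α, hα⟩ := (h1.1.2.1 u hu).1
    exact (hs (show (u, α) ∈ saSet T₁ π₁ from ⟨hu, hα⟩)).1
  have hmono : ∀ (T₁ : Set S) (π₁ : S → Set A) (T₂ : Set S) (π₂ : S → Set A),
      SubMDPIncl T₁ π₁ T₂ π₂ → saSet T₁ π₁ ⊆ saSet T₂ π₂ := by
    rintro T₁ π₁ T₂ π₂ h ⟨u, α⟩ ⟨hu, hα⟩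
    exact ⟨h.1 hu, h.2 u hu hα⟩
  let P : Set (Set (S × A)) := {Z | ∃ T' π', M.IsEC T' π' ∧ saSet T' π' = Z}
  obtain ⟨Z, hle, hmax⟩ := (Set.toFinite P).exists_le_maximal
    (show saSet T π ∈ P from ⟨T, π, hec, rfl⟩)
  obtain ⟨T', π', hec', rfl⟩ := hmax.prop
  refine ⟨T', π', ⟨hec', fun T₂ π₂ h2 hi => ?_⟩, hiff _ _ _ _ hec hle⟩
  exact hiff _ _ _ _ h2 (hmax.le_of_ge ⟨T₂, π₂, h2, rfl⟩ (hmono _ _ _ _ hi))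

theorem h15_scc_ec (M : MDP S A) {T : Set S} {π : S → Set A} (hsub : M.IsSubMDP T π)
    {s : S} (hs : s ∈ T) (h0 : M.ROut T π (M.SCC T π s) = ∅) :
    M.IsEC (M.SCC T π s) (restrictTo π (M.SCC T π s)) := by
  have hcl : ∀ u ∈ M.SCC T π s, ∀ α ∈ π u, ∀ t, 0 < M.δ u α t → t ∈ M.SCC T π s := by
    intro u hu α hα t hd
    by_contra hc
    have : (u, α) ∈ M.ROut T π (M.SCC T π s) :=
      ⟨hu, hα, t, ⟨hsub.2.2 u hu.1 α hα t hd, hc⟩, hd⟩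
    rw [h0] at this
    exact this
  refine ⟨⟨⟨s, hs, .refl, .refl⟩, fun u hu => ⟨?_, fun α hα => (hsub.2.1 u hu.1).2 α hα.1⟩,
    fun u hu α hα t hd => hcl u hu α hα.1 t hd⟩, ?_⟩
  · obtain ⟨α, hα⟩ := (hsub.2.1 u hu.1).1
    exact ⟨α, hα, hu⟩
  · intro a ha b hb
    have hr : M.Reach T π a b := ha.2.2.trans hb.2.1
    clear hb
    induction hr using Relation.ReflTransGen.head_induction_on with
    | refl => exact .refl
    | head hst _ ih =>
      obtain ⟨-, α, hα, hd⟩ := hst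
      exact .head ⟨ha, α, ⟨hα, ha⟩, hd⟩ (ih (hcl _ ha α hα _ hd))

theorem h15_scc_mec (M : MDP S A) {T : Set S} {π : S → Set A} (hsub : M.IsSubMDP T π)
    (hclosed : M.MECClosed T π)
    {s : S} (hs : s ∈ T) (h0 : M.ROut T π (M.SCC T π s) = ∅) :
    M.IsMEC (M.SCC T π s) (restrictTo π (M.SCC T π s)) := by
  refine ⟨h15_scc_ec M hsub hs h0, fun T₂ π₂ h2 hi => ?_⟩
  obtain ⟨T', π', hm, hi'⟩ := h15_exists_mec M h2
  have hsC : s ∈ M.SCC T π s := ⟨hs, .refl, .refl⟩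
  have hsT : s ∈ T' := hi'.1 (hi.1 hsC)
  have hc := hclosed s hs T' π' hm hsT
  have hsubC : T' ⊆ M.SCC T π s := fun u hu =>
    ⟨hc.1 hu, h15_reach_mono M hc (hm.1.2 s hsT u hu), h15_reach_mono M hc (hm.1.2 u hu s hsT)⟩
  exact ⟨hi'.1.trans hsubC, fun u hu α hα =>
    ⟨hc.2 u (hi'.1 hu) (hi'.2 u hu hα), hsubC (hi'.1 hu)⟩⟩

end helpers15

/-- Let `M` be an MDP, `(T,π)` an MEC-closed sub-MDP of `M`, `s ∈ T`,
`F_s` the forward-reachable set and `C_s` the SCC of `s` in `G(T,π)`,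
`(U1, X1) = Attr_{(T,π)}(ROut_{(T,π)}(C_s))`,
`(U3, X3) = Attr_{(T,π)}(ROut_{(T,π)}(T \ F_s))`, and set
`V1 = C_s \ U1`, `V2 = F_s \ C_s`, `V3 = (T \ F_s) \ U3`.
Writing `MECs_M(W)` for the set of MECs (in canonical form) of states in `W`:
if `X1 ≠ ∅` then `MECs_M(T) = MECs_M(V1) ∪ MECs_M(V2) ∪ MECs_M(V3)`, and
if `X1 = ∅` then `MECs_M(T) = {(C_s, π|_{C_s})} ∪ MECs_M(V2) ∪ MECs_M(V3)`. -/
theorem stmt15 (M : MDP S A) (T : Set S) (π : S → Set A)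
    (hsub : M.IsSubMDP T π) (hclosed : M.MECClosed T π)
    (s : S) (hs : s ∈ T)
    (U1 : Set S) (X1 : Set (S × A))
    (hattr1 : (U1, X1) = M.Attr T π (M.ROut T π (M.SCC T π s)))
    (U3 : Set S) (X3 : Set (S × A))
    (hattr3 : (U3, X3) = M.Attr T π (M.ROut T π (T \ M.Fwd T π s)))
    (V1 : Set S) (hV1 : V1 = M.SCC T π s \ U1)
    (V2 : Set S) (hV2 : V2 = M.Fwd T π s \ M.SCC T π s)
    (V3 : Set S) (hV3 : V3 = (T \ M.Fwd T π s) \ U3) :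
    (X1 ≠ ∅ → M.MECsOf T = M.MECsOf V1 ∪ M.MECsOf V2 ∪ M.MECsOf V3) ∧
    (X1 = ∅ → M.MECsOf T =
      {(M.SCC T π s, restrictTo π (M.SCC T π s))} ∪ M.MECsOf V2 ∪ M.MECsOf V3) := by
  have e1 : U1 = (M.Attr T π (M.ROut T π (M.SCC T π s))).1 := congrArg Prod.fst hattr1
  have eX : X1 = (M.Attr T π (M.ROut T π (M.SCC T π s))).2 := congrArg Prod.snd hattr1
  have e3 : U3 = (M.Attr T π (M.ROut T π (T \ M.Fwd T π s))).1 := congrArg Prod.fst hattr3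
  have hmono : ∀ W, W ⊆ T → M.MECsOf W ⊆ M.MECsOf T := by
    rintro W hW p ⟨⟨t, ht, htp⟩, h⟩
    exact ⟨⟨t, hW ht, htp⟩, h⟩
  have hV1T : V1 ⊆ T := by rw [hV1]; exact fun u hu => hu.1.1
  have hV2T : V2 ⊆ T := by rw [hV2]; exact fun u hu => hu.1.1
  have hV3T : V3 ⊆ T := by rw [hV3]; exact fun u hu => hu.1.1
  -- MECs meeting the SCC are contained in it
  have hC : ∀ p ∈ M.MECsOf T, ∀ t ∈ p.1, t ∈ M.SCC T π s → p.1 ⊆ M.SCC T π s := by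
    rintro p ⟨-, hm, -⟩ t htp htC u hu
    have hc := hclosed t htC.1 p.1 p.2 hm htp
    exact ⟨hc.1 hu, htC.2.1.trans (h15_reach_mono M hc (hm.1.2 t htp u hu)),
      (h15_reach_mono M hc (hm.1.2 u hu t htp)).trans htC.2.2⟩
  have h23 : ∀ p ∈ M.MECsOf T, ∀ t ∈ p.1, t ∈ T → t ∉ M.SCC T π s →
      p ∈ M.MECsOf V2 ∪ M.MECsOf V3 := by
    rintro p ⟨-, hm, hcan⟩ t htp htT htC
    have hc := hclosed t htT p.1 p.2 hm htp
    by_cases htF : t ∈ M.Fwd T π s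
    · exact Or.inl ⟨⟨t, by rw [hV2]; exact ⟨htF, htC⟩, htp⟩, hm, hcan⟩
    · refine Or.inr ⟨⟨t, ?_, htp⟩, hm, hcan⟩
      rw [hV3, e3]
      refine ⟨⟨htT, htF⟩, h15_attr_rout M _ hm.1 hc ?_ t htp⟩
      exact fun u hu => ⟨hc.1 hu, fun hF =>
        htF ⟨htT, hF.2.trans (h15_reach_mono M hc (hm.1.2 u hu t htp))⟩⟩
  constructor
  · intro _
    apply Set.Subset.antisymm
    · intro p hp
      obtain ⟨⟨t, htT, htp⟩, hm, hcan⟩ := id hp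
      rw [Set.union_assoc]
      by_cases htC : t ∈ M.SCC T π s
      · refine Or.inl ⟨⟨t, ?_, htp⟩, hm, hcan⟩
        rw [hV1, e1]
        exact ⟨htC, h15_attr_rout M _ hm.1 (hclosed t htT _ _ hm htp) (hC p hp t htp htC) t htp⟩
      · exact Or.inr (h23 p hp t htp htT htC)
    · exact Set.union_subset (Set.union_subset (hmono _ hV1T) (hmono _ hV2T)) (hmono _ hV3T)
  · intro hX
    have h0 : M.ROut T π (M.SCC T π s) = ∅ := by
      rw [← Set.subset_empty_iff, ← hX, eX]
      exact fun q hq => Set.mem_iUnion.2 ⟨0, hq⟩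
    have hmec := h15_scc_mec M hsub hclosed hs h0
    apply Set.Subset.antisymm
    · intro p hp
      obtain ⟨⟨t, htT, htp⟩, hm, hcan⟩ := id hp
      rw [Set.union_assoc]
      by_cases htC : t ∈ M.SCC T π s
      · left
        have hc := hclosed t htT _ _ hm htp
        have hsC := hC p hp t htp htC
        have hr := hm.2 _ _ hmec.1 ⟨hsC, fun u hu α hα => ⟨hc.2 u hu hα, hsC hu⟩⟩
        refine Prod.ext (Set.Subset.antisymm hsC hr.1) (funext fun u => ?_)
        by_cases hu : u ∈ p.1
        · exact Set.Subset.antisymm (fun α hα => ⟨hc.2 u hu hα, hsC hu⟩) (hr.2 u (hsC hu))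
        · rw [hcan u hu]
          exact (Set.eq_empty_of_forall_notMem fun α hα => hu (hr.1 hα.2)).symm
      · exact Or.inr (h23 p hp t htp htT htC)
    · refine Set.union_subset (Set.union_subset ?_ (hmono _ hV2T)) (hmono _ hV3T)
      rintro p rfl
      exact ⟨⟨s, hs, hs, .refl, .refl⟩, hmec, fun u hu =>
        Set.eq_empty_of_forall_notMem fun α hα => hu hα.2⟩
end
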